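/- Let f be a real-valued function on the set of all finite-dimensional density matrices that is continuous on the density matrices of each fixed dimension, additive in the sense that f(ρ ⊗ σ) = f(ρ) + f(σ), and monotone under correlating-catalytic transitions, i.e. whenever there exist a density matrix σ and a unitary U with tr₂[U(ρ ⊗ σ)U†] = ρ' and tr₁[U(ρ ⊗ σ)U†] = σ, then f(ρ) ≤ f(ρ'). Then there exist a constant a ≥ 0 and constants b_n ∈ ℝ (one for each dimension n) with b_{mn} = b_m + b_n for all m, n, such that f(ρ) = a·S(ρ) + b_n for every density matrix ρ of dimension n. -/

import Mathlib

open scoped Kronecker ComplexOrder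
open Matrix

noncomputable section

/-- `ρ` is a density matrix: positive semidefinite with unit trace. -/
def IsDensityMatrix {ι : Type*} [Fintype ι] (ρ : Matrix ι ι ℂ) : Prop :=
  ρ.PosSemidef ∧ ρ.trace = 1

/-- Partial trace over the second tensor factor. -/
def ptrace2 {ι κ : Type*} [Fintype κ] (M : Matrix (ι × κ) (ι × κ) ℂ) : Matrix ι ι ℂ :=
  Matrix.of fun i j => ∑ k, M (i, k) (j, k)

/-- Partial trace over the first tensor factor. -/
def ptrace1 {ι κ : Type*} [Fintype ι] (M : Matrix (ι × κ) (ι × κ) ℂ) : Matrix κ κ ℂ :=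
  Matrix.of fun i j => ∑ k, M (k, i) (k, j)

/-- Dephasing (decoherence) channel in the fixed (standard) orthonormal basis `{|j⟩}`:
`D[σ] = ∑ j ⟨j|σ|j⟩ |j⟩⟨j|`. -/
def deph {ι : Type*} [DecidableEq ι] (M : Matrix ι ι ℂ) : Matrix ι ι ℂ :=
  Matrix.diagonal fun j => M j j

/-- The eigenvalue list of a matrix (junk value `0` if not Hermitian). -/
def eigs {ι : Type*} [Fintype ι] [DecidableEq ι] (ρ : Matrix ι ι ℂ) : ι → ℝ :=
  if h : ρ.IsHermitian then h.eigenvalues else 0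

/-- The spectrum of a matrix, as a multiset of real eigenvalues (with multiplicity). -/
def spectra {ι : Type*} [Fintype ι] [DecidableEq ι] (ρ : Matrix ι ι ℂ) : Multiset ℝ :=
  Finset.univ.val.map (eigs ρ)

/-- von Neumann entropy `S(ρ) = -tr(ρ log ρ)`, i.e. the Shannon entropy
of the eigenvalue list (natural logarithm). -/
def vN {ι : Type*} [Fintype ι] [DecidableEq ι] (ρ : Matrix ι ι ℂ) : ℝ :=
  ∑ i, Real.negMulLog (eigs ρ i)

/-- Maximally mixed state `𝟙_d = (1/d)·I_d`. -/
def mm (d : ℕ) : Matrix (Fin d) (Fin d) ℂ :=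
  (d : ℂ)⁻¹ • (1 : Matrix (Fin d) (Fin d) ℂ)

/-- Kronecker (tensor) product, reindexed to a `Fin (n * m)`-indexed matrix. -/
def kron {n m : ℕ} (ρ : Matrix (Fin n) (Fin n) ℂ) (σ : Matrix (Fin m) (Fin m) ℂ) :
    Matrix (Fin (n * m)) (Fin (n * m)) ℂ :=
  Matrix.reindex finProdFinEquiv finProdFinEquiv (ρ ⊗ₖ σ)

theorem IsDensityMatrix.kronecker {X Y : Type*} [Fintype X] [Fintype Y]
    {ρ : Matrix X X ℂ} {σ : Matrix Y Y ℂ} (hρ : IsDensityMatrix ρ) (hσ : IsDensityMatrix σ) :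
    IsDensityMatrix (ρ ⊗ₖ σ) := by
  classical
  exact ⟨hρ.1.kronecker hσ.1, by rw [trace_kronecker, hρ.2, hσ.2, one_mul]⟩

theorem IsDensityMatrix.reindex {X Y : Type*} [Fintype X] [Fintype Y]
    {ρ : Matrix X X ℂ} (hρ : IsDensityMatrix ρ) (e : X ≃ Y) :
    IsDensityMatrix (Matrix.reindex e e ρ) :=
  ⟨hρ.1.submatrix e.symm, by
    rw [← hρ.2]; exact Equiv.sum_comp e.symm (fun i => ρ i i)⟩

theorem IsDensityMatrix.conj {X : Type*} [Fintype X] [DecidableEq X]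
    {ρ : Matrix X X ℂ} (hρ : IsDensityMatrix ρ) {U : Matrix X X ℂ}
    (hU : U ∈ unitaryGroup X ℂ) : IsDensityMatrix (U * ρ * Uᴴ) :=
  ⟨hρ.1.mul_mul_conjTranspose_same U, by
    have h : Uᴴ * U = 1 := mem_unitaryGroup_iff'.1 hU
    rw [trace_mul_comm, ← Matrix.mul_assoc, h, Matrix.one_mul, hρ.2]⟩

theorem ptrace2_kronecker {X Y : Type*} [Fintype Y] (A : Matrix X X ℂ) (B : Matrix Y Y ℂ) :
    ptrace2 (A ⊗ₖ B) = B.trace • A := by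
  ext i j
  simp [ptrace2, trace, ← Finset.mul_sum, mul_comm]

theorem ptrace1_kronecker {X Y : Type*} [Fintype X] (A : Matrix X X ℂ) (B : Matrix Y Y ℂ) :
    ptrace1 (A ⊗ₖ B) = A.trace • B := by
  ext i j
  simp [ptrace1, trace, ← Finset.sum_mul]

theorem ptrace2_reindex {X Y X' Y' : Type*} [Fintype Y] [Fintype Y'] (e : X ≃ X') (e' : Y ≃ Y')
    (A : Matrix (X × Y) (X × Y) ℂ) :
    ptrace2 (reindex (e.prodCongr e') (e.prodCongr e') A) = reindex e e (ptrace2 A) := by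
  ext i j
  simp only [ptrace2, of_apply, reindex_apply, submatrix_apply]
  exact Equiv.sum_comp e'.symm (fun k => A (e.symm i, k) (e.symm j, k))

theorem ptrace1_reindex {X Y X' Y' : Type*} [Fintype X] [Fintype X'] (e : X ≃ X') (e' : Y ≃ Y')
    (A : Matrix (X × Y) (X × Y) ℂ) :
    ptrace1 (reindex (e.prodCongr e') (e.prodCongr e') A) = reindex e' e' (ptrace1 A) := by
  ext i j
  simp only [ptrace1, of_apply, reindex_apply, submatrix_apply]
  exact Equiv.sum_comp e.symm (fun k => A (k, e'.symm i) (k, e'.symm j))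

theorem trace_ptrace2 {X Y : Type*} [Fintype X] [Fintype Y] (A : Matrix (X × Y) (X × Y) ℂ) :
    (ptrace2 A).trace = A.trace := by
  simp [trace, ptrace2, Fintype.sum_prod_type]

theorem trace_ptrace1 {X Y : Type*} [Fintype X] [Fintype Y] (A : Matrix (X × Y) (X × Y) ℂ) :
    (ptrace1 A).trace = A.trace := by
  simp [trace, ptrace1, Fintype.sum_prod_type_right]

theorem IsDensityMatrix.ptrace2 {X Y : Type*} [Fintype X] [Fintype Y]
    {ρ : Matrix (X × Y) (X × Y) ℂ} (hρ : IsDensityMatrix ρ) : IsDensityMatrix (ptrace2 ρ) := by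
  refine ⟨?_, by rw [trace_ptrace2, hρ.2]⟩
  have h : _root_.ptrace2 ρ = ∑ y, ρ.submatrix (fun x => (x, y)) (fun x => (x, y)) := by
    ext i j
    simp [_root_.ptrace2, Matrix.sum_apply]
  rw [h]
  exact posSemidef_sum _ fun y _ => hρ.1.submatrix _

theorem IsDensityMatrix.ptrace1 {X Y : Type*} [Fintype X] [Fintype Y]
    {ρ : Matrix (X × Y) (X × Y) ℂ} (hρ : IsDensityMatrix ρ) : IsDensityMatrix (ptrace1 ρ) := by
  refine ⟨?_, by rw [trace_ptrace1, hρ.2]⟩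
  have h : _root_.ptrace1 ρ = ∑ x, ρ.submatrix (fun y => (x, y)) (fun y => (x, y)) := by
    ext i j
    simp [_root_.ptrace1, Matrix.sum_apply]
  rw [h]
  exact posSemidef_sum _ fun y _ => hρ.1.submatrix _

/-- The permutation matrix acting on matrices by simultaneously permuting rows and columns. -/
def permUnitary {X : Type*} [DecidableEq X] (π : X ≃ X) : Matrix X X ℂ :=
  (1 : Matrix X X ℂ).submatrix π id

theorem permUnitary_conj {X : Type*} [Fintype X] [DecidableEq X] (π : X ≃ X) (A : Matrix X X ℂ) :
    permUnitary π * A * (permUnitary π)ᴴ = A.submatrix π π := by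
  ext i j
  simp [permUnitary, mul_apply, one_apply]

theorem permUnitary_mem {X : Type*} [Fintype X] [DecidableEq X] (π : X ≃ X) :
    permUnitary π ∈ unitaryGroup X ℂ := by
  rw [mem_unitaryGroup_iff]
  have h := permUnitary_conj π 1
  rwa [Matrix.mul_one, submatrix_one_equiv] at h

theorem reindex_mem_unitaryGroup {X Y : Type*} [Fintype X] [DecidableEq X] [Fintype Y]
    [DecidableEq Y] (e : X ≃ Y) {U : Matrix X X ℂ} (hU : U ∈ unitaryGroup X ℂ) :
    reindex e e U ∈ unitaryGroup Y ℂ := by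
  rw [mem_unitaryGroup_iff] at hU ⊢
  rw [star_eq_conjTranspose] at hU ⊢
  rw [conjTranspose_reindex, reindex_apply, reindex_apply, submatrix_mul_equiv, hU,
    submatrix_one_equiv]

/-- Continuity, additivity and monotonicity under correlating-catalytic transitions. -/
structure IsCatalyticMonotone (f : ∀ n : ℕ, Matrix (Fin n) (Fin n) ℂ → ℝ) : Prop where
  cont : ∀ n : ℕ, ContinuousOn (f n) {ρ | IsDensityMatrix ρ}
  add : ∀ (n m : ℕ) (ρ : Matrix (Fin n) (Fin n) ℂ) (σ : Matrix (Fin m) (Fin m) ℂ),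
    IsDensityMatrix ρ → IsDensityMatrix σ → f (n * m) (kron ρ σ) = f n ρ + f m σ
  mono : ∀ (n : ℕ) (ρ ρ' : Matrix (Fin n) (Fin n) ℂ),
    IsDensityMatrix ρ → IsDensityMatrix ρ' →
    (∃ (m : ℕ) (σ : Matrix (Fin m) (Fin m) ℂ),
      IsDensityMatrix σ ∧
      ∃ U ∈ Matrix.unitaryGroup (Fin n × Fin m) ℂ,
        ptrace2 (U * (ρ ⊗ₖ σ) * Uᴴ) = ρ' ∧
        ptrace1 (U * (ρ ⊗ₖ σ) * Uᴴ) = σ) →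
    f n ρ ≤ f n ρ'

/-- Transport of `f` to matrices indexed by an arbitrary finite type. -/
def onType (f : ∀ n : ℕ, Matrix (Fin n) (Fin n) ℂ → ℝ) {X : Type*} [Fintype X]
    (ρ : Matrix X X ℂ) : ℝ :=
  f (Fintype.card X) (reindex (Fintype.equivFin X) (Fintype.equivFin X) ρ)

namespace IsCatalyticMonotone

variable {f : ∀ n : ℕ, Matrix (Fin n) (Fin n) ℂ → ℝ}

theorem le_conj (hf : IsCatalyticMonotone f) {n : ℕ} {ρ U : Matrix (Fin n) (Fin n) ℂ}
    (hρ : IsDensityMatrix ρ) (hU : U ∈ unitaryGroup (Fin n) ℂ) :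
    f n ρ ≤ f n (U * ρ * Uᴴ) := by
  have h1 : IsDensityMatrix (1 : Matrix (Fin 1) (Fin 1) ℂ) := ⟨PosSemidef.one, by simp⟩
  have h : (U ⊗ₖ (1 : Matrix (Fin 1) (Fin 1) ℂ)) * (ρ ⊗ₖ 1) * (U ⊗ₖ 1)ᴴ
      = (U * ρ * Uᴴ) ⊗ₖ (1 : Matrix (Fin 1) (Fin 1) ℂ) := by
    rw [conjTranspose_kronecker, ← mul_kronecker_mul, ← mul_kronecker_mul]
    simp
  refine hf.mono n ρ _ hρ (hρ.conj hU) ⟨1, 1, h1, U ⊗ₖ 1,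
    kronecker_mem_unitary hU (one_mem _), ?_, ?_⟩
  · rw [h, ptrace2_kronecker, h1.2, one_smul]
  · rw [h, ptrace1_kronecker, (hρ.conj hU).2, one_smul]

theorem conj_eq (hf : IsCatalyticMonotone f) {n : ℕ} {ρ U : Matrix (Fin n) (Fin n) ℂ}
    (hρ : IsDensityMatrix ρ) (hU : U ∈ unitaryGroup (Fin n) ℂ) :
    f n (U * ρ * Uᴴ) = f n ρ := by
  refine le_antisymm ?_ (hf.le_conj hρ hU)
  have h := hf.le_conj (hρ.conj hU) (Unitary.star_mem hU)
  have hU' : Uᴴ * U = 1 := mem_unitaryGroup_iff'.1 hU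
  rw [star_eq_conjTranspose, conjTranspose_conjTranspose] at h
  rwa [show Uᴴ * (U * ρ * Uᴴ) * U = (Uᴴ * U) * ρ * (Uᴴ * U) by simp only [Matrix.mul_assoc],
    hU', Matrix.one_mul, Matrix.mul_one] at h

theorem onType_eq (hf : IsCatalyticMonotone f) {X : Type*} [Fintype X] {ρ : Matrix X X ℂ}
    (hρ : IsDensityMatrix ρ) {n : ℕ} (e : X ≃ Fin n) : onType f ρ = f n (reindex e e ρ) := by
  have hn : n = Fintype.card X := by simpa using (Fintype.card_congr e).symm
  subst hn
  rw [onType, ← hf.conj_eq (hρ.reindex e) (permUnitary_mem ((Fintype.equivFin X).symm.trans e)),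
    permUnitary_conj]
  congr 1
  ext i j
  simp

theorem onType_fin (hf : IsCatalyticMonotone f) {n : ℕ} {ρ : Matrix (Fin n) (Fin n) ℂ}
    (hρ : IsDensityMatrix ρ) : onType f ρ = f n ρ := by
  rw [hf.onType_eq hρ (Equiv.refl _)]
  simp

theorem onType_conj (hf : IsCatalyticMonotone f) {X : Type*} [Fintype X] [DecidableEq X]
    {ρ U : Matrix X X ℂ} (hρ : IsDensityMatrix ρ) (hU : U ∈ unitaryGroup X ℂ) :
    onType f (U * ρ * Uᴴ) = onType f ρ := by
  rw [onType, onType, ← hf.conj_eq (hρ.reindex _)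
    (reindex_mem_unitaryGroup (Fintype.equivFin X) hU), conjTranspose_reindex]
  simp only [reindex_apply, submatrix_mul_equiv]

theorem onType_kronecker (hf : IsCatalyticMonotone f) {X Y : Type*} [Fintype X] [Fintype Y]
    {ρ : Matrix X X ℂ} {σ : Matrix Y Y ℂ} (hρ : IsDensityMatrix ρ) (hσ : IsDensityMatrix σ) :
    onType f (ρ ⊗ₖ σ) = onType f ρ + onType f σ := by
  rw [hf.onType_eq (hρ.kronecker hσ)
    (((Fintype.equivFin X).prodCongr (Fintype.equivFin Y)).trans finProdFinEquiv),
    onType, onType, ← hf.add _ _ _ _ (hρ.reindex _) (hσ.reindex _)]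
  rfl

theorem onType_mono (hf : IsCatalyticMonotone f) {X Z : Type*} [Fintype X] [DecidableEq X]
    [Fintype Z] [DecidableEq Z] {ρ ρ' : Matrix X X ℂ} {σ : Matrix Z Z ℂ}
    (hρ : IsDensityMatrix ρ) (hρ' : IsDensityMatrix ρ') (hσ : IsDensityMatrix σ)
    {U : Matrix (X × Z) (X × Z) ℂ} (hU : U ∈ unitaryGroup (X × Z) ℂ)
    (h2 : ptrace2 (U * (ρ ⊗ₖ σ) * Uᴴ) = ρ') (h1 : ptrace1 (U * (ρ ⊗ₖ σ) * Uᴴ) = σ) :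
    onType f ρ ≤ onType f ρ' := by
  set e := Fintype.equivFin X
  set e' := Fintype.equivFin Z
  have h : reindex (e.prodCongr e') (e.prodCongr e') U * (reindex e e ρ ⊗ₖ reindex e' e' σ) *
      (reindex (e.prodCongr e') (e.prodCongr e') U)ᴴ
      = reindex (e.prodCongr e') (e.prodCongr e') (U * (ρ ⊗ₖ σ) * Uᴴ) := by
    rw [conjTranspose_reindex,
      show reindex e e ρ ⊗ₖ reindex e' e' σ
        = reindex (e.prodCongr e') (e.prodCongr e') (ρ ⊗ₖ σ) from rfl]
    simp only [reindex_apply, submatrix_mul_equiv]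
  refine hf.mono _ _ _ (hρ.reindex e) (hρ'.reindex e) ⟨_, _, hσ.reindex e', _,
    reindex_mem_unitaryGroup (e.prodCongr e') hU, ?_, ?_⟩
  · rw [h, ptrace2_reindex, h2]
  · rw [h, ptrace1_reindex, h1]

/-- Subadditivity: the catalyst is a copy of the second marginal, which is swapped with the
second subsystem. -/
theorem onType_le_add (hf : IsCatalyticMonotone f) {X Y : Type*} [Fintype X] [DecidableEq X]
    [Fintype Y] [DecidableEq Y] {ρ : Matrix (X × Y) (X × Y) ℂ} (hρ : IsDensityMatrix ρ) :
    onType f ρ ≤ onType f (ptrace2 ρ) + onType f (ptrace1 ρ) := by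
  rw [← hf.onType_kronecker hρ.ptrace2 hρ.ptrace1]
  let π : (X × Y) × Y ≃ (X × Y) × Y :=
    { toFun := fun z => ((z.1.1, z.2), z.1.2)
      invFun := fun z => ((z.1.1, z.2), z.1.2)
      left_inv := fun _ => rfl
      right_inv := fun _ => rfl }
  refine hf.onType_mono hρ (hρ.ptrace2.kronecker hρ.ptrace1) hρ.ptrace1 (permUnitary_mem π) ?_ ?_
  · rw [permUnitary_conj]
    ext ⟨x, y⟩ ⟨x', y'⟩
    simp [ptrace2, π, Finset.sum_mul]
  · rw [permUnitary_conj]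
    ext y y'
    calc ∑ z : X × Y, ρ (z.1, y) (z.1, y') * ptrace1 ρ z.2 z.2
        = (∑ x, ρ (x, y) (x, y')) * ∑ y, ptrace1 ρ y y := by
          rw [Fintype.sum_prod_type, Finset.sum_mul_sum]
      _ = ptrace1 ρ y y' := by
          rw [show ∑ y, ptrace1 ρ y y = 1 from hρ.ptrace1.2, mul_one]; rfl

end IsCatalyticMonotone

/-- `p` is a probability vector. -/
def IsProb {X : Type*} [Fintype X] (p : X → ℝ) : Prop :=
  (∀ i, 0 ≤ p i) ∧ ∑ i, p i = 1

/-- The diagonal matrix with real diagonal `p`. -/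
def diagState {X : Type*} [DecidableEq X] (p : X → ℝ) : Matrix X X ℂ :=
  diagonal fun i => (p i : ℂ)

/-- Move weight `t` from the entry at `i` to the entry at `k`. -/
def transfer {X : Type*} [DecidableEq X] (p : X → ℝ) (i k : X) (t : ℝ) : X → ℝ :=
  fun x => p x - (if x = i then t else 0) + (if x = k then t else 0)

/-- The product of two vectors, indexed by the product type. -/
def prodVec {X Y : Type*} (p : X → ℝ) (q : Y → ℝ) : X × Y → ℝ :=
  fun z => p z.1 * q z.2

theorem IsProb.isDensityMatrix {X : Type*} [Fintype X] [DecidableEq X] {p : X → ℝ}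
    (hp : IsProb p) : IsDensityMatrix (diagState p) := by
  refine ⟨PosSemidef.diagonal fun i => ?_, ?_⟩
  · simpa using hp.1 i
  · rw [diagState, trace_diagonal]
    exact_mod_cast hp.2

theorem IsProb.prodVec {X Y : Type*} [Fintype X] [Fintype Y] {p : X → ℝ} {q : Y → ℝ}
    (hp : IsProb p) (hq : IsProb q) : IsProb (prodVec p q) := by
  refine ⟨fun z => mul_nonneg (hp.1 _) (hq.1 _), ?_⟩
  simp only [_root_.prodVec, Fintype.sum_prod_type, ← Finset.sum_mul_sum, hp.2, hq.2, mul_one]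

theorem IsProb.le_one {X : Type*} [Fintype X] {p : X → ℝ} (hp : IsProb p) (i : X) : p i ≤ 1 :=
  hp.2 ▸ Finset.single_le_sum (fun j _ => hp.1 j) (Finset.mem_univ i)

theorem diagState_prodVec {X Y : Type*} [DecidableEq X] [DecidableEq Y] (p : X → ℝ) (q : Y → ℝ) :
    diagState (prodVec p q) = diagState p ⊗ₖ diagState q := by
  simp [diagState, prodVec, diagonal_kronecker_diagonal]

theorem IsProb.transfer {X : Type*} [Fintype X] [DecidableEq X] {p : X → ℝ} (hp : IsProb p)
    {i k : X} {t : ℝ} (hi : t ≤ p i) (hk : -p k ≤ t) : IsProb (transfer p i k t) := by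
  refine ⟨fun x => ?_, by simp [_root_.transfer, Finset.sum_add_distrib, hp.2]⟩
  have := hp.1 x
  unfold _root_.transfer
  split_ifs with h1 h2 h2
  · linarith
  · subst h1; linarith
  · subst h2; linarith
  · linarith

theorem transfer_transfer {X : Type*} [DecidableEq X] (p : X → ℝ) (i k : X) (s t : ℝ) :
    transfer (transfer p i k s) i k t = transfer p i k (s + t) := by
  ext x
  unfold transfer
  split_ifs <;> ring

theorem transfer_swap {X : Type*} [DecidableEq X] (p : X → ℝ) (i k : X) (t : ℝ) :
    transfer p k i t = transfer p i k (-t) := by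
  ext x
  unfold transfer
  split_ifs <;> ring

theorem ptrace2_diagState {X Y : Type*} [DecidableEq X] [DecidableEq Y] [Fintype Y]
    (P : X × Y → ℝ) : ptrace2 (diagState P) = diagState fun x => ∑ y, P (x, y) := by
  ext i j
  by_cases h : i = j
  · subst h; simp [ptrace2, diagState]
  · simp [ptrace2, diagState, h]

theorem ptrace1_diagState {X Y : Type*} [DecidableEq X] [DecidableEq Y] [Fintype X]
    (P : X × Y → ℝ) : ptrace1 (diagState P) = diagState fun y => ∑ x, P (x, y) := by
  ext i j
  by_cases h : i = j
  · subst h; simp [ptrace1, diagState]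
  · simp [ptrace1, diagState, h]

theorem marginal_fst_transfer {X Y : Type*} [DecidableEq X] [DecidableEq Y] [Fintype Y]
    {p : X → ℝ} {q : Y → ℝ} (hq : ∑ y, q y = 1) (z w : X × Y) (t : ℝ) :
    (fun x => ∑ y, transfer (prodVec p q) z w t (x, y)) = transfer p z.1 w.1 t := by
  ext x
  simp [transfer, prodVec, Finset.sum_add_distrib, ← Finset.mul_sum, hq, Prod.ext_iff, ite_and]

theorem marginal_snd_transfer {X Y : Type*} [DecidableEq X] [DecidableEq Y] [Fintype X]
    {p : X → ℝ} {q : Y → ℝ} (hp : ∑ x, p x = 1) (z w : X × Y) (t : ℝ) :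
    (fun y => ∑ x, transfer (prodVec p q) z w t (x, y)) = transfer q z.2 w.2 t := by
  ext y
  simp [transfer, prodVec, Finset.sum_add_distrib, ← Finset.sum_mul, hp, Prod.ext_iff, ite_and]

/-- Rotation with cosine `c` and sine `s` in the plane spanned by the basis vectors `z`, `w`. -/
def planeRotation {X : Type*} [DecidableEq X] (z w : X) (c s : ℝ) : Matrix X X ℂ :=
  of fun a b =>
    if a = z then (if b = z then (c : ℂ) else 0) + (if b = w then (s : ℂ) else 0)
    else if a = w then (if b = w then (c : ℂ) else 0) - (if b = z then (s : ℂ) else 0)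
    else if b = a then 1 else 0

theorem planeRotation_conj_diagState {X : Type*} [Fintype X] [DecidableEq X] {z w : X}
    (hzw : z ≠ w) {c s : ℝ} (hcs : c ^ 2 + s ^ 2 = 1) (p : X → ℝ) :
    planeRotation z w c s * diagState p * (planeRotation z w c s)ᴴ
      = diagState (transfer p z w (s ^ 2 * (p z - p w)))
        + of fun a b => if (a = z ∧ b = w) ∨ (a = w ∧ b = z) then
            ((c * s * (p w - p z) : ℝ) : ℂ) else 0 := by
  have hc : (c : ℂ) ^ 2 = 1 - (s : ℂ) ^ 2 := by
    rw [eq_sub_iff_add_eq]; exact_mod_cast hcs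
  ext a b
  simp only [diagState, mul_apply, conjTranspose_apply, planeRotation, of_apply,
    Matrix.add_apply, diagonal_apply, transfer]
  by_cases haz : a = z
  · subst haz
    by_cases hbz : b = a
    · subst hbz
      simp [hzw, hzw.symm, add_mul, mul_add, Finset.sum_add_distrib]
      linear_combination (p b : ℂ) * hc
    · by_cases hbw : b = w
      · subst hbw
        simp [hzw, hzw.symm, add_mul, mul_sub, Finset.sum_add_distrib]
        ring
      · simp [hzw, hbz, hbw, Ne.symm hbz, add_mul]
  · by_cases haw : a = w
    · subst haw
      by_cases hbz : b = z
      · subst hbz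
        simp [hzw, hzw.symm, mul_add, sub_mul, Finset.sum_add_distrib]
        ring
      · by_cases hbw : b = a
        · subst hbw
          simp [hzw, hzw.symm, sub_mul, mul_sub]
          linear_combination (p b : ℂ) * hc
        · simp [hzw.symm, hbz, hbw, Ne.symm hbw, sub_mul]
    · by_cases hbz : b = z
      · subst hbz
        simp [hzw, haz, haw, mul_add, Finset.sum_add_distrib]
      · by_cases hbw : b = w
        · subst hbw
          simp [hzw.symm, haz, haw, mul_sub]
        · by_cases hab : a = b
          · subst hab; simp [haz, haw]
          · simp [haz, haw, hbz, hbw, hab, Ne.symm hab]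

theorem planeRotation_mem {X : Type*} [Fintype X] [DecidableEq X] {z w : X}
    (hzw : z ≠ w) {c s : ℝ} (hcs : c ^ 2 + s ^ 2 = 1) :
    planeRotation z w c s ∈ unitaryGroup X ℂ := by
  have h := planeRotation_conj_diagState hzw hcs (fun _ => 1)
  have h1 : diagState (fun _ : X => (1 : ℝ)) = 1 := by simp [diagState]
  rw [mem_unitaryGroup_iff, star_eq_conjTranspose]
  rw [h1, Matrix.mul_one] at h
  rw [h]
  ext a b
  simp [transfer, diagState, one_apply]

namespace IsCatalyticMonotone

variable {f : ∀ n : ℕ, Matrix (Fin n) (Fin n) ℂ → ℝ}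

theorem onType_prodVec (hf : IsCatalyticMonotone f) {X Y : Type*} [Fintype X] [DecidableEq X]
    [Fintype Y] [DecidableEq Y] {p : X → ℝ} {q : Y → ℝ} (hp : IsProb p) (hq : IsProb q) :
    onType f (diagState (prodVec p q)) = onType f (diagState p) + onType f (diagState q) := by
  rw [diagState_prodVec, hf.onType_kronecker hp.isDensityMatrix hq.isDensityMatrix]

/-- Subadditivity for the classically correlated state obtained by a transfer of weight. -/
theorem onType_transfer_prodVec_le (hf : IsCatalyticMonotone f) {X Y : Type*} [Fintype X]
    [DecidableEq X] [Fintype Y] [DecidableEq Y] {p : X → ℝ} {q : Y → ℝ} (hp : IsProb p)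
    (hq : IsProb q) {z w : X × Y} {t : ℝ} (h0 : 0 ≤ t) (ht : t ≤ p z.1 * q z.2) :
    onType f (diagState (transfer (prodVec p q) z w t))
      ≤ onType f (diagState (transfer p z.1 w.1 t))
        + onType f (diagState (transfer q z.2 w.2 t)) := by
  have h := hf.onType_le_add ((hp.prodVec hq).transfer (i := z) (k := w) ht
    ((neg_nonpos.2 ((hp.prodVec hq).1 w)).trans h0)).isDensityMatrix
  rwa [ptrace2_diagState, ptrace1_diagState, marginal_fst_transfer hq.2,
    marginal_snd_transfer hp.2] at h

/-- Rotating a product state in the plane of two basis vectors that differ in both tensor factors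
produces off-diagonal terms which are invisible to the marginals. -/
theorem add_le_transfer (hf : IsCatalyticMonotone f) {X Y : Type*} [Fintype X]
    [DecidableEq X] [Fintype Y] [DecidableEq Y] {p : X → ℝ} {q : Y → ℝ} (hp : IsProb p)
    (hq : IsProb q) {i k : X} {j l : Y} (hik : i ≠ k) (hjl : j ≠ l) {t : ℝ} (h0 : 0 ≤ t)
    (ht : t ≤ p i * q j - p k * q l) :
    onType f (diagState p) + onType f (diagState q)
      ≤ onType f (diagState (transfer p i k t)) + onType f (diagState (transfer q j l t)) := by
  obtain ⟨c, s, hcs, hs⟩ : ∃ c s : ℝ, c ^ 2 + s ^ 2 = 1 ∧ s ^ 2 * (p i * q j - p k * q l) = t := by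
    rcases h0.eq_or_lt with rfl | h0
    · exact ⟨1, 0, by norm_num, by norm_num⟩
    have hpos := h0.trans_le ht
    have h1 : 0 ≤ t / (p i * q j - p k * q l) := by positivity
    have h2 : t / (p i * q j - p k * q l) ≤ 1 := (div_le_one hpos).2 ht
    refine ⟨√(1 - t / (p i * q j - p k * q l)), √(t / (p i * q j - p k * q l)), ?_, ?_⟩
    · rw [Real.sq_sqrt h1, Real.sq_sqrt (by linarith)]; ring
    · rw [Real.sq_sqrt h1]; field_simp
  have hne : ((i, j) : X × Y) ≠ (k, l) := fun h => hik (congrArg Prod.fst h)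
  have hPQ := (hp.prodVec hq).isDensityMatrix
  have hU := planeRotation_mem hne hcs
  rw [← hf.onType_prodVec hp hq, ← hf.onType_conj hPQ hU]
  have h := hf.onType_le_add (hPQ.conj hU)
  rw [planeRotation_conj_diagState hne hcs] at h ⊢
  simp only [prodVec] at h ⊢
  rw [hs] at h ⊢
  refine h.trans (le_of_eq ?_)
  congr 2
  · rw [← marginal_fst_transfer (p := p) hq.2 (i, j) (k, l) t, ← ptrace2_diagState]
    ext a b
    simp only [ptrace2, of_apply, Matrix.add_apply, Finset.sum_add_distrib]
    refine add_eq_left.2 (Finset.sum_eq_zero fun y _ => if_neg ?_)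
    simp only [Prod.mk.injEq]
    rintro (⟨⟨-, rfl⟩, -, h⟩ | ⟨⟨-, rfl⟩, -, h⟩)
    · exact hjl h
    · exact hjl h.symm
  · rw [← marginal_snd_transfer (q := q) hp.2 (i, j) (k, l) t, ← ptrace1_diagState]
    ext a b
    simp only [ptrace1, of_apply, Matrix.add_apply, Finset.sum_add_distrib]
    refine add_eq_left.2 (Finset.sum_eq_zero fun y _ => if_neg ?_)
    simp only [Prod.mk.injEq]
    rintro (⟨⟨rfl, -⟩, h, -⟩ | ⟨⟨rfl, -⟩, h, -⟩)
    · exact hik h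
    · exact hik h.symm

/-- Tensor powers of a diagonal state, together with the subadditivity bound for transfers between
two constant strings. -/
theorem exists_power (hf : IsCatalyticMonotone f) {X : Type} [Fintype X] [DecidableEq X]
    {p : X → ℝ} (hp : IsProb p) {i k : X} (hik : i ≠ k) (M : ℕ) :
    ∃ (Y : Type) (_ : Fintype Y) (_ : DecidableEq Y) (P : Y → ℝ) (z w : Y), z ≠ w ∧ IsProb P ∧
      P z = p i ^ (M + 1) ∧ P w = p k ^ (M + 1) ∧
      onType f (diagState P) = (M + 1) * onType f (diagState p) ∧
      ∀ t, 0 ≤ t → t ≤ P z → onType f (diagState (transfer P z w t))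
        ≤ (M + 1) * onType f (diagState (transfer p i k t)) := by
  induction M with
  | zero => exact ⟨X, inferInstance, inferInstance, p, i, k, hik, hp, by simp, by simp, by simp,
      fun t _ _ => by simp⟩
  | succ M ih =>
    obtain ⟨Y, _, _, P, z, w, hzw, hP, hz, hw, hval, htr⟩ := ih
    refine ⟨X × Y, inferInstance, inferInstance, prodVec p P, (i, z), (k, w),
      fun h => hik (congrArg Prod.fst h), hp.prodVec hP, ?_, ?_, ?_, fun t h0 ht => ?_⟩
    · simp only [prodVec, hz]; ring
    · simp only [prodVec, hw]; ring
    · rw [hf.onType_prodVec hp hP, hval]; push_cast; ring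
    · have h1 := hf.onType_transfer_prodVec_le hp hP (z := (i, z)) (w := (k, w)) h0 ht
      have h2 := htr t h0 (ht.trans (mul_le_of_le_one_left (hP.1 z) (hp.le_one i)))
      push_cast
      simp only at h1
      linarith

theorem power_add_le_transfer (hf : IsCatalyticMonotone f) {X Y : Type} [Fintype X]
    [DecidableEq X] [Fintype Y] [DecidableEq Y] {p : X → ℝ} {q : Y → ℝ} (hp : IsProb p)
    (hq : IsProb q) {i k : X} {j l : Y} (hik : i ≠ k) (hjl : j ≠ l) {M N : ℕ} (hM : 0 < M)
    (hN : 0 < N) {t : ℝ} (h0 : 0 ≤ t) (ht : t ≤ p i ^ M * q j ^ N - p k ^ M * q l ^ N) :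
    M * onType f (diagState p) + N * onType f (diagState q)
      ≤ M * onType f (diagState (transfer p i k t))
        + N * onType f (diagState (transfer q j l t)) := by
  obtain ⟨M, rfl⟩ := Nat.exists_eq_add_one.2 hM
  obtain ⟨N, rfl⟩ := Nat.exists_eq_add_one.2 hN
  obtain ⟨A, _, _, P, z, w, hzw, hP, hz, hw, hval, htr⟩ := hf.exists_power hp hik M
  obtain ⟨B, _, _, Q, z', w', hzw', hQ, hz', hw', hval', htr'⟩ := hf.exists_power hq hjl N
  rw [← hz, ← hw, ← hz', ← hw'] at ht
  have h1 := hf.add_le_transfer hP hQ hzw hzw' h0 ht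
  have hle : t ≤ P z * Q z' := ht.trans (sub_le_self _ (mul_nonneg (hP.1 _) (hQ.1 _)))
  have h2 := htr t h0 (hle.trans (mul_le_of_le_one_right (hP.1 _) (hQ.le_one _)))
  have h3 := htr' t h0 (hle.trans (mul_le_of_le_one_left (hQ.1 _) (hP.le_one _)))
  push_cast
  linarith

end IsCatalyticMonotone

section Integration

open Filter Set Topology

theorem image_right_le_left_of_frequently {G : ℝ → ℝ} {a b : ℝ} (hab : a ≤ b)
    (hG : ContinuousOn G (Icc a b))
    (h : ∀ t ∈ Ioo a b, ∀ ε > 0, ∃ᶠ δ in 𝓝[>] (0 : ℝ), G (t + δ) - G t < ε * δ) :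
    G b ≤ G a := by
  rcases hab.eq_or_lt with rfl | hab
  · exact le_rfl
  have key : ∀ a' ∈ Ioo a b, G b ≤ G a' := fun a' ha' =>
    image_le_of_liminf_slope_right_le_deriv_boundary (B := fun _ => G a') (B' := fun _ => 0)
      (hG.mono (Icc_subset_Icc_left ha'.1.le)) le_rfl continuousOn_const
      (fun x _ => hasDerivWithinAt_const x _ _)
      (fun x hx r hr => by
        have hx' := h x ⟨ha'.1.trans_le hx.1, hx.2⟩ r hr
        have hmap : map (fun δ => x + δ) (𝓝[>] (0 : ℝ)) = 𝓝[>] x := by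
          rw [map_add_left_nhdsGT, add_zero]
        rw [← hmap, frequently_map]
        refine (hx'.and_eventually self_mem_nhdsWithin).mono fun δ ⟨h1, h2⟩ => ?_
        rw [slope_def_field, add_sub_cancel_left]
        exact (div_lt_iff₀ h2).2 h1)
      ⟨ha'.2.le, le_rfl⟩
  have hlim : Tendsto G (𝓝[>] a) (𝓝 (G a)) :=
    (hG a ⟨le_rfl, hab.le⟩).mono_of_mem_nhdsWithin (Icc_mem_nhdsGT hab)
  exact ge_of_tendsto hlim (mem_of_superset (Ioo_mem_nhdsGT hab) key)

theorem sub_le_sub_of_frequently_forward {F W w : ℝ → ℝ} {a b : ℝ} (hab : a ≤ b)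
    (hF : ContinuousOn F (Icc a b)) (hW : ContinuousOn W (Icc a b))
    (hw : ∀ t ∈ Ioo a b, HasDerivAt W (w t) t)
    (h : ∀ t ∈ Ioo a b, ∃ᶠ δ in 𝓝[>] (0 : ℝ), w t * δ ≤ F (t + δ) - F t) :
    W b - W a ≤ F b - F a := by
  have := image_right_le_left_of_frequently (G := fun t => W t - F t) hab (hW.sub hF)
    fun t ht ε hε => by
      have h1 : ∀ᶠ δ in 𝓝[>] (0 : ℝ), δ⁻¹ • (W (t + δ) - W t) < w t + ε :=
        (hw t ht).tendsto_slope_zero_right.eventually_lt_const (by linarith)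
      refine ((h t ht).and_eventually (h1.and self_mem_nhdsWithin)).mono fun δ ⟨h2, h3, h4⟩ => ?_
      rw [smul_eq_mul, inv_mul_lt_iff₀ h4] at h3
      linarith
  linarith

theorem sub_le_sub_of_frequently_backward {F W w : ℝ → ℝ} {a b : ℝ} (hab : a ≤ b)
    (hF : ContinuousOn F (Icc a b)) (hW : ContinuousOn W (Icc a b))
    (hw : ∀ t ∈ Ioo a b, HasDerivAt W (w t) t)
    (h : ∀ t ∈ Ioo a b, ∃ᶠ δ in 𝓝[>] (0 : ℝ), F t - F (t - δ) ≤ w t * δ) :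
    F b - F a ≤ W b - W a := by
  have hmaps : MapsTo (fun s : ℝ => -s) (Icc (-b) (-a)) (Icc a b) :=
    fun s hs => ⟨by linarith [hs.2], by linarith [hs.1]⟩
  have := sub_le_sub_of_frequently_forward (F := fun s => F (-s)) (W := fun s => W (-s))
    (w := fun s => -w (-s)) (neg_le_neg hab) (hF.comp continuousOn_neg hmaps)
    (hW.comp continuousOn_neg hmaps)
    (fun s hs => by
      have hs' : -s ∈ Ioo a b := ⟨by linarith [hs.2], by linarith [hs.1]⟩
      exact ((hw (-s) hs').comp s (hasDerivAt_neg s)).congr_deriv (mul_neg_one _))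
    (fun s hs => (h (-s) ⟨by linarith [hs.2], by linarith [hs.1]⟩).mono fun δ hδ => by
      rw [show -(s + δ) = -s - δ by ring]
      linarith)
  simp only [neg_neg] at this
  linarith

theorem exists_nat_ratio {u v c d : ℝ} (hu : 0 < u) (hv : 0 < v) (hcd : c < d) :
    ∃ M N : ℕ, 0 < M ∧ 0 < N ∧ N * v < M * u ∧ M * (c * u) ≤ N * (d * v) := by
  have hx : 0 < u / v := div_pos hu hv
  have h1 : ∀ᶠ r in 𝓝[<] (u / v), c * (u / v) < r * d :=
    (tendsto_nhdsWithin_of_tendsto_nhds (tendsto_id.mul_const d)).eventually_const_lt (by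
      rw [mul_comm]; exact mul_lt_mul_of_pos_left hcd hx)
  have h2 : ∀ᶠ r in 𝓝[<] (u / v), 0 < r :=
    (tendsto_nhdsWithin_of_tendsto_nhds tendsto_id).eventually_const_lt hx
  obtain ⟨l, hl, hsub⟩ := mem_nhdsLT_iff_exists_Ioo_subset.1 (h1.and h2)
  obtain ⟨r, hr1, hr2⟩ := exists_rat_btwn (mem_Iio.1 hl)
  obtain ⟨h3, h4⟩ := hsub ⟨hr1, hr2⟩
  have hrpos : 0 < r := by exact_mod_cast h4
  have hden : (0 : ℝ) < r.den := by exact_mod_cast r.den_pos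
  have hnum : ((r.num.toNat : ℕ) : ℝ) = r * r.den := by
    have : ((r.num.toNat : ℕ) : ℤ) = r.num := Int.toNat_of_nonneg (Rat.num_pos.2 hrpos).le
    have h5 : ((r.num.toNat : ℕ) : ℝ) = (r.num : ℝ) := by exact_mod_cast this
    rw [h5]
    exact_mod_cast (Rat.mul_den_eq_num r).symm
  refine ⟨r.den, r.num.toNat, r.den_pos, by have := Rat.num_pos.2 hrpos; omega, ?_, ?_⟩
  · rw [hnum]
    rw [lt_div_iff₀ hv] at hr2
    nlinarith
  · rw [hnum]
    have h6 : c * u < r * d * v := by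
      rwa [← mul_div_assoc, div_lt_iff₀ hv] at h3
    nlinarith

end Integration

/-- Shannon entropy of a real vector. -/
def shannon {X : Type*} [Fintype X] (p : X → ℝ) : ℝ := ∑ i, Real.negMulLog (p i)

theorem continuous_transfer {X : Type*} [DecidableEq X] (p : X → ℝ) (i k : X) :
    Continuous fun t => transfer p i k t := by
  refine continuous_pi fun x => ?_
  unfold transfer
  split_ifs <;> fun_prop

theorem continuous_shannon {X : Type*} [Fintype X] : Continuous (shannon (X := X)) :=
  continuous_finsetSum _ fun i _ => Real.continuous_negMulLog.comp (continuous_apply i)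

theorem hasDerivAt_shannon_transfer {X : Type*} [Fintype X] [DecidableEq X] (p : X → ℝ) {i k : X}
    (hik : i ≠ k) {t : ℝ} (hi : 0 < p i - t) (hk : 0 < p k + t) :
    HasDerivAt (fun t => shannon (transfer p i k t)) (Real.log ((p i - t) / (p k + t))) t := by
  have h : ∀ x ∈ Finset.univ, HasDerivAt (fun t => Real.negMulLog (transfer p i k t x))
      ((if x = i then Real.log (p i - t) + 1 else 0)
        + (if x = k then -Real.log (p k + t) - 1 else 0)) t := by
    intro x _
    unfold transfer
    by_cases hxi : x = i
    · subst hxi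
      have h1 : HasDerivAt (fun t => p x - t) (-1) t := by
        simpa using (hasDerivAt_id t).const_sub (p x)
      have h2 := (Real.hasDerivAt_negMulLog hi.ne').comp t h1
      simp only [if_true, if_neg hik, add_zero]
      exact h2.congr_deriv (by ring)
    · by_cases hxk : x = k
      · subst hxk
        have h1 : HasDerivAt (fun t => p x + t) 1 t := by
          simpa using (hasDerivAt_id t).const_add (p x)
        have h2 := (Real.hasDerivAt_negMulLog hk.ne').comp t h1
        simp only [if_true, if_neg hxi, zero_add, sub_zero]
        exact h2.congr_deriv (by ring)
      · simp only [if_neg hxi, if_neg hxk, add_zero]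
        exact hasDerivAt_const _ _
  refine (HasDerivAt.fun_sum h).congr_deriv ?_
  rw [Finset.sum_add_distrib, Finset.sum_ite_eq' , Finset.sum_ite_eq', Real.log_div hi.ne' hk.ne']
  simp
  ring

namespace IsCatalyticMonotone

open Filter Set Topology

variable {f : ∀ n : ℕ, Matrix (Fin n) (Fin n) ℂ → ℝ}

theorem continuousOn_transfer (hf : IsCatalyticMonotone f) {X : Type*} [Fintype X] [DecidableEq X]
    {p : X → ℝ} (hp : IsProb p) (i k : X) :
    ContinuousOn (fun t => onType f (diagState (transfer p i k t))) (Icc (-p k) (p i)) := by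
  refine (hf.cont (Fintype.card X)).comp (Continuous.continuousOn ?_)
    fun t ht => (hp.transfer ht.2 ht.1).isDensityMatrix.reindex _
  have h : Continuous fun t => diagState (transfer p i k t) :=
    Continuous.matrix_diagonal <| continuous_pi fun x =>
      Complex.continuous_ofReal.comp ((continuous_apply x).comp (continuous_transfer p i k))
  exact h.matrix_submatrix _ _

/-- A lower bound on the rate of increase of `f` per unit of entropy, when approaching some
diagonal state from a less disordered direction. -/
def HasRate (f : ∀ n : ℕ, Matrix (Fin n) (Fin n) ℂ → ℝ) (c : ℝ) : Prop :=
  ∃ (Y : Type) (_ : Fintype Y) (_ : DecidableEq Y) (q : Y → ℝ) (j l : Y), IsProb q ∧ j ≠ l ∧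
    0 < q l ∧ q l < q j ∧ ∀ᶠ δ in 𝓝[>] (0 : ℝ), c * Real.log (q j / q l) * δ
      ≤ onType f (diagState q) - onType f (diagState (transfer q l j δ))

theorem HasRate.eventually_le (hf : IsCatalyticMonotone f) {c d : ℝ} (hd : HasRate f d)
    (hcd : c < d) {X : Type} [Fintype X] [DecidableEq X] {p : X → ℝ} (hp : IsProb p) {i k : X}
    (hik : i ≠ k) (hk : 0 < p k) (hki : p k < p i) :
    ∀ᶠ δ in 𝓝[>] (0 : ℝ), c * Real.log (p i / p k) * δ
      ≤ onType f (diagState (transfer p i k δ)) - onType f (diagState p) := by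
  obtain ⟨Y, _, _, q, j, l, hq, hjl, hl, hlj, hrate⟩ := hd
  have hu : 0 < Real.log (p i / p k) := Real.log_pos ((one_lt_div hk).2 hki)
  have hv : 0 < Real.log (q j / q l) := Real.log_pos ((one_lt_div hl).2 hlj)
  obtain ⟨M, N, hM, hN, h1, h2⟩ := exists_nat_ratio hu hv hcd
  have hi := hk.trans hki
  have hj := hl.trans hlj
  have hpos : 0 < p i ^ M * q l ^ N - p k ^ M * q j ^ N := by
    rw [sub_pos, ← Real.log_lt_log_iff (by positivity) (by positivity),
      Real.log_mul (by positivity) (by positivity), Real.log_mul (by positivity) (by positivity),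
      Real.log_pow, Real.log_pow, Real.log_pow, Real.log_pow]
    rw [Real.log_div hi.ne' hk.ne', Real.log_div hj.ne' hl.ne'] at h1
    linarith
  filter_upwards [hrate, self_mem_nhdsWithin, Ioo_mem_nhdsGT hpos] with δ h3 h4 h5
  have h6 := hf.power_add_le_transfer hp hq hik hjl.symm hM hN (le_of_lt h4) h5.2.le
  have hM' : (0 : ℝ) < M := by exact_mod_cast hM
  refine le_of_mul_le_mul_left ?_ hM'
  have h7 := mul_le_mul_of_nonneg_left h3 (Nat.cast_nonneg (α := ℝ) N)
  have h8 := mul_le_mul_of_nonneg_right h2 (le_of_lt h4)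
  linarith

variable {X : Type} [Fintype X] [DecidableEq X] {p : X → ℝ} {i k : X} {L : ℝ}

theorem HasRate.mul_shannon_le (hf : IsCatalyticMonotone f) {c d : ℝ} (hd : HasRate f d)
    (hcd : c < d) (hp : IsProb p) (hik : i ≠ k) (hL0 : 0 ≤ L) (hL : 2 * L ≤ p i - p k) :
    c * shannon (transfer p i k L) - c * shannon (transfer p i k 0)
      ≤ onType f (diagState (transfer p i k L)) - onType f (diagState (transfer p i k 0)) := by
  have hi := hp.1 i
  have hk := hp.1 k
  refine sub_le_sub_of_frequently_forward
    (F := fun t => onType f (diagState (transfer p i k t)))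
    (W := fun t => c * shannon (transfer p i k t)) hL0
    ((hf.continuousOn_transfer hp i k).mono (Icc_subset_Icc (by linarith) (by linarith)))
    (continuous_const.mul
      (continuous_shannon.comp (continuous_transfer p i k))).continuousOn
    (fun t ht => (hasDerivAt_shannon_transfer p hik (by linarith [ht.1, ht.2])
      (by linarith [ht.1])).const_mul c) fun t ht => ?_
  have ht1 := ht.1
  have ht2 := ht.2
  have h := hd.eventually_le hf hcd (p := transfer p i k t) (i := i) (k := k)
    (hp.transfer (by linarith) (by linarith)) hik
    (by simp [transfer, hik.symm]; linarith) (by simp [transfer, hik, hik.symm]; linarith)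
  simp only [transfer_transfer] at h
  simpa [transfer, hik, hik.symm] using h.frequently

theorem le_mul_shannon_of_not_hasRate (hf : IsCatalyticMonotone f) {c : ℝ} (hc : ¬ HasRate f c)
    (hp : IsProb p) (hik : i ≠ k) (hL0 : 0 ≤ L) (hL : 2 * L ≤ p i - p k) :
    onType f (diagState (transfer p i k L)) - onType f (diagState (transfer p i k 0))
      ≤ c * shannon (transfer p i k L) - c * shannon (transfer p i k 0) := by
  have hi := hp.1 i
  have hk := hp.1 k
  refine sub_le_sub_of_frequently_backward
    (F := fun t => onType f (diagState (transfer p i k t)))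
    (W := fun t => c * shannon (transfer p i k t)) hL0
    ((hf.continuousOn_transfer hp i k).mono (Icc_subset_Icc (by linarith) (by linarith)))
    (continuous_const.mul
      (continuous_shannon.comp (continuous_transfer p i k))).continuousOn
    (fun t ht => (hasDerivAt_shannon_transfer p hik (by linarith [ht.1, ht.2])
      (by linarith [ht.1])).const_mul c) fun t ht => ?_
  have ht1 := ht.1
  have ht2 := ht.2
  by_contra hcon
  refine hc ⟨X, inferInstance, inferInstance, transfer p i k t, i, k,
    hp.transfer (by linarith) (by linarith), hik, by simp [transfer, hik.symm]; linarith,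
    by simp [transfer, hik, hik.symm]; linarith, ?_⟩
  filter_upwards [not_frequently.1 hcon] with δ hδ
  rw [transfer_swap (transfer p i k t), transfer_transfer, ← sub_eq_add_neg]
  simpa [transfer, hik, hik.symm] using (not_le.1 hδ).le

end IsCatalyticMonotone

/-- The point mass at `0` on two points. -/
def pointMass : Fin 2 → ℝ := ![1, 0]

theorem isProb_pointMass : IsProb pointMass :=
  ⟨fun i => by fin_cases i <;> simp [pointMass], by simp [pointMass]⟩

theorem transfer_zero {X : Type*} [DecidableEq X] (p : X → ℝ) (i k : X) :
    transfer p i k 0 = p := by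
  ext x
  simp [transfer]

theorem transfer_pointMass : transfer pointMass 0 1 (1 / 2) = fun _ => 1 / 2 := by
  ext x
  fin_cases x <;> norm_num [transfer, pointMass]

theorem shannon_transfer_pointMass :
    shannon (transfer pointMass 0 1 (1 / 2)) - shannon (transfer pointMass 0 1 0) = Real.log 2 := by
  rw [transfer_pointMass, transfer_zero]
  simp [shannon, pointMass, Real.negMulLog]

namespace IsCatalyticMonotone

variable {f : ∀ n : ℕ, Matrix (Fin n) (Fin n) ℂ → ℝ}

/-- The increment of `f` from a pure qubit state to the maximally mixed one, per unit of
entropy. -/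
def rate (f : ∀ n : ℕ, Matrix (Fin n) (Fin n) ℂ → ℝ) : ℝ :=
  (onType f (diagState fun _ : Fin 2 => 1 / 2) - onType f (diagState pointMass)) / Real.log 2

theorem hasRate_of_lt (hf : IsCatalyticMonotone f) {c : ℝ} (hc : c < rate f) : HasRate f c := by
  by_contra h
  have h1 := hf.le_mul_shannon_of_not_hasRate h isProb_pointMass (i := 0) (k := 1) (L := 1 / 2)
    (by decide) (by norm_num) (by norm_num [pointMass])
  rw [← mul_sub, shannon_transfer_pointMass, transfer_pointMass, transfer_zero] at h1
  exact absurd ((div_le_iff₀ (Real.log_pos one_lt_two)).2 h1) (not_le.2 hc)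

theorem not_hasRate_of_gt (hf : IsCatalyticMonotone f) {c : ℝ} (hc : rate f < c) :
    ¬ HasRate f c := by
  intro h
  obtain ⟨d, hd1, hd2⟩ := exists_between hc
  have h1 := h.mul_shannon_le hf hd2 isProb_pointMass (i := 0) (k := 1) (L := 1 / 2)
    (by decide) (by norm_num) (by norm_num [pointMass])
  rw [← mul_sub, shannon_transfer_pointMass, transfer_pointMass, transfer_zero] at h1
  exact absurd ((le_div_iff₀ (Real.log_pos one_lt_two)).2 h1) (not_le.2 hd1)

theorem transfer_sub_eq (hf : IsCatalyticMonotone f) {X : Type} [Fintype X] [DecidableEq X]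
    {p : X → ℝ} {i k : X} {L : ℝ} (hp : IsProb p) (hik : i ≠ k) (hL0 : 0 ≤ L)
    (hL : 2 * L ≤ p i - p k) :
    onType f (diagState (transfer p i k L)) - onType f (diagState p)
      = rate f * (shannon (transfer p i k L) - shannon p) := by
  have hlim : ∀ (l : Filter ℝ), l ≤ nhds (rate f) → Filter.Tendsto
      (fun c => c * shannon (transfer p i k L) - c * shannon (transfer p i k 0)) l
      (nhds (rate f * (shannon (transfer p i k L) - shannon p))) := fun l hl => by
    simp only [← mul_sub, transfer_zero]
    exact (Filter.tendsto_id.mono_left hl).mul_const _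
  refine le_antisymm ?_ ?_
  · refine ge_of_tendsto (hlim _ (nhdsWithin_le_nhds (s := Set.Ioi (rate f)))) ?_
    filter_upwards [self_mem_nhdsWithin] with c hc
    have := hf.le_mul_shannon_of_not_hasRate (hf.not_hasRate_of_gt hc) hp hik hL0 hL
    rwa [transfer_zero] at this ⊢
  · refine le_of_tendsto (hlim _ (nhdsWithin_le_nhds (s := Set.Iio (rate f)))) ?_
    filter_upwards [self_mem_nhdsWithin] with c hc
    obtain ⟨d, hd1, hd2⟩ := exists_between (Set.mem_Iio.1 hc)
    have := (hf.hasRate_of_lt hd2).mul_shannon_le hf hd1 hp hik hL0 hL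
    rwa [transfer_zero] at this ⊢

/-- A correlated pair of uniform bits has the same value as a pure bit and a uniform bit. -/
theorem rate_nonneg (hf : IsCatalyticMonotone f) : 0 ≤ rate f := by
  have hu : IsProb fun _ : Fin 2 => (1 / 2 : ℝ) := ⟨fun _ => by norm_num, by norm_num⟩
  have hP := (isProb_pointMass.prodVec hu).isDensityMatrix
  let π : Fin 2 × Fin 2 ≃ Fin 2 × Fin 2 :=
    { toFun := fun z => (z.1 + z.2, z.2)
      invFun := fun z => (z.1 - z.2, z.2)
      left_inv := fun z => by simp
      right_inv := fun z => by simp }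
  have h := hf.onType_le_add (hP.conj (permUnitary_mem π))
  rw [hf.onType_conj hP (permUnitary_mem π), hf.onType_prodVec isProb_pointMass hu,
    permUnitary_conj, show (diagState (prodVec pointMass fun _ : Fin 2 => (1 / 2 : ℝ))).submatrix
      π π = diagState ((prodVec pointMass fun _ : Fin 2 => (1 / 2 : ℝ)) ∘ π) from
      submatrix_diagonal_equiv _ _, ptrace2_diagState, ptrace1_diagState] at h
  have h1 : (fun x => ∑ y, ((prodVec pointMass fun _ : Fin 2 => (1 / 2 : ℝ)) ∘ π) (x, y))
      = fun _ => 1 / 2 := by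
    ext x; fin_cases x <;> simp [prodVec, pointMass, π]
  have h2 : (fun y => ∑ x, ((prodVec pointMass fun _ : Fin 2 => (1 / 2 : ℝ)) ∘ π) (x, y))
      = fun _ => 1 / 2 := by
    ext x; fin_cases x <;> simp [prodVec, pointMass, π]
  rw [h1, h2] at h
  exact div_nonneg (by linarith) (Real.log_pos one_lt_two).le

theorem onType_sub_shannon (hf : IsCatalyticMonotone f) {X : Type} [Fintype X] [DecidableEq X]
    {p : X → ℝ} (hp : IsProb p) :
    onType f (diagState p) - rate f * shannon p
      = onType f (diagState fun _ : X => (1 / Fintype.card X : ℝ))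
        - rate f * shannon fun _ : X => (1 / Fintype.card X : ℝ) := by
  set u : ℝ := 1 / Fintype.card X with hu
  induction hm : (Finset.univ.filter fun x => p x ≠ u).card using Nat.strong_induction_on
    generalizing p with
  | _ m ih =>
    have hX : Nonempty X := by
      by_contra hX
      rw [not_nonempty_iff] at hX
      simpa using hp.2
    have hsum : ∑ _ : X, u = ∑ x, p x := by
      rw [hp.2, hu]; simp
    by_cases hpu : ∀ x, p x = u
    · rw [funext hpu]
    · have hhi : ∃ i, u < p i := by
        by_contra! hle
        exact hpu fun x => (Finset.sum_eq_sum_iff_of_le fun x _ => hle x).1 hsum.symm x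
          (Finset.mem_univ x)
      have hlo : ∃ k, p k < u := by
        by_contra! hle
        exact hpu fun x => ((Finset.sum_eq_sum_iff_of_le fun x _ => hle x).1 hsum x
          (Finset.mem_univ x)).symm
      obtain ⟨i, hi⟩ := hhi
      obtain ⟨k, hk⟩ := hlo
      have hik : i ≠ k := fun h => by subst h; linarith
      set L := min (p i - u) (u - p k) with hLdef
      have hL1 : L ≤ p i - u := min_le_left _ _
      have hL2 : L ≤ u - p k := min_le_right _ _
      have hL0 : 0 ≤ L := le_min (by linarith) (by linarith)
      have hu0 : 0 ≤ u := (hp.1 k).trans hk.le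
      have h1 := hf.transfer_sub_eq hp hik hL0 (by linarith)
      have hp' : IsProb (transfer p i k L) :=
        hp.transfer (by linarith) (by linarith [hp.1 k])
      have h2 := ih _ ?_ hp' rfl
      · linarith
      · rw [← hm]
        refine Finset.card_lt_card (Finset.ssubset_iff_subset_ne.2 ⟨fun x => ?_, fun heq => ?_⟩)
        · simp only [Finset.mem_filter, Finset.mem_univ, true_and]
          intro hx hxu
          have hxi : x ≠ i := fun h => by subst h; linarith
          have hxk : x ≠ k := fun h => by subst h; linarith
          exact hx (by simp [transfer, hxi, hxk, hxu])
        · have hi' : i ∈ Finset.univ.filter fun x => p x ≠ u := by simp [hi.ne']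
          have hk' : k ∈ Finset.univ.filter fun x => p x ≠ u := by simp [hk.ne]
          rw [← heq] at hi' hk'
          replace hi' := (Finset.mem_filter.1 hi').2
          replace hk' := (Finset.mem_filter.1 hk').2
          simp only [transfer, hik, hik.symm, if_true, if_false] at hi' hk'
          rcases min_choice (p i - u) (u - p k) with h | h
          · exact hi' (by rw [hLdef, h]; ring)
          · exact hk' (by rw [hLdef, h]; ring)

end IsCatalyticMonotone

theorem shannon_uniform {n : ℕ} (hn : 0 < n) :
    shannon (fun _ : Fin n => (1 / n : ℝ)) = Real.log n := by
  have : (n : ℝ) ≠ 0 := by positivity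
  simp [shannon, Real.negMulLog]
  field_simp

theorem isProb_uniform {n : ℕ} (hn : 0 < n) : IsProb fun _ : Fin n => (1 / n : ℝ) := by
  have : (n : ℝ) ≠ 0 := by positivity
  exact ⟨fun _ => by positivity, by simp [this]⟩

theorem kron_uniform (m n : ℕ) :
    kron (diagState fun _ : Fin m => (1 / m : ℝ)) (diagState fun _ : Fin n => (1 / n : ℝ))
      = diagState fun _ : Fin (m * n) => (1 / (m * n : ℕ) : ℝ) := by
  rw [kron, ← diagState_prodVec, diagState, diagState, reindex_apply, submatrix_diagonal_equiv]
  congr 1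
  ext x
  simp [prodVec, mul_comm]

theorem IsDensityMatrix.isProb_eigs {n : ℕ} {ρ : Matrix (Fin n) (Fin n) ℂ}
    (hρ : IsDensityMatrix ρ) : IsProb (eigs ρ) := by
  rw [eigs, dif_pos hρ.1.isHermitian]
  refine ⟨hρ.1.eigenvalues_nonneg, ?_⟩
  apply Complex.ofReal_injective
  push_cast
  exact hρ.1.isHermitian.trace_eq_sum_eigenvalues.symm.trans hρ.2

theorem IsDensityMatrix.exists_conj_eigs {n : ℕ} {ρ : Matrix (Fin n) (Fin n) ℂ}
    (hρ : IsDensityMatrix ρ) : ∃ U ∈ unitaryGroup (Fin n) ℂ, ρ = U * diagState (eigs ρ) * Uᴴ := by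
  rw [eigs, dif_pos hρ.1.isHermitian]
  exact ⟨_, hρ.1.isHermitian.eigenvectorUnitary.2, hρ.1.isHermitian.spectral_theorem⟩

/-- Any real function on density matrices which is continuous (in each fixed
dimension), additive under tensor products, and monotone under correlating-catalytic
transitions is of the form `f(ρ) = a·S(ρ) + b_n` with `a ≥ 0` and `b_{mn} = b_m + b_n`. -/
theorem stmt5 (f : ∀ n : ℕ, Matrix (Fin n) (Fin n) ℂ → ℝ)
    (hcont : ∀ n : ℕ, ContinuousOn (f n) {ρ | IsDensityMatrix ρ})
    (hadd : ∀ (n m : ℕ) (ρ : Matrix (Fin n) (Fin n) ℂ) (σ : Matrix (Fin m) (Fin m) ℂ),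
      IsDensityMatrix ρ → IsDensityMatrix σ → f (n * m) (kron ρ σ) = f n ρ + f m σ)
    (hmono : ∀ (n : ℕ) (ρ ρ' : Matrix (Fin n) (Fin n) ℂ),
      IsDensityMatrix ρ → IsDensityMatrix ρ' →
      (∃ (m : ℕ) (σ : Matrix (Fin m) (Fin m) ℂ),
        IsDensityMatrix σ ∧
        ∃ U ∈ Matrix.unitaryGroup (Fin n × Fin m) ℂ,
          ptrace2 (U * (ρ ⊗ₖ σ) * Uᴴ) = ρ' ∧
          ptrace1 (U * (ρ ⊗ₖ σ) * Uᴴ) = σ) →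
      f n ρ ≤ f n ρ') :
    ∃ (a : ℝ) (b : ℕ → ℝ), 0 ≤ a ∧
      (∀ m n : ℕ, 0 < m → 0 < n → b (m * n) = b m + b n) ∧
      ∀ (n : ℕ) (ρ : Matrix (Fin n) (Fin n) ℂ), IsDensityMatrix ρ →
        f n ρ = a * vN ρ + b n := by
  have hf : IsCatalyticMonotone f := ⟨hcont, hadd, hmono⟩
  refine ⟨IsCatalyticMonotone.rate f, fun n => f n (diagState fun _ : Fin n => (1 / n : ℝ))
    - IsCatalyticMonotone.rate f * Real.log n, hf.rate_nonneg, fun m n hm hn => ?_,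
    fun n ρ hρ => ?_⟩
  · simp only
    rw [← kron_uniform, hadd m n _ _ (isProb_uniform hm).isDensityMatrix
      (isProb_uniform hn).isDensityMatrix, Nat.cast_mul,
      Real.log_mul (by positivity) (by positivity)]
    ring
  · have hn : 0 < n := by
      rcases Nat.eq_zero_or_pos n with rfl | hn
      · simpa using hρ.2
      · exact hn
    obtain ⟨U, hU, hUρ⟩ := hρ.exists_conj_eigs
    have h := hf.onType_sub_shannon hρ.isProb_eigs
    simp only [Fintype.card_fin] at h
    rw [hf.onType_fin hρ.isProb_eigs.isDensityMatrix, shannon_uniform hn,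
      hf.onType_fin (isProb_uniform hn).isDensityMatrix,
      ← hf.conj_eq hρ.isProb_eigs.isDensityMatrix hU, ← hUρ] at h
    have hv : vN ρ = shannon (eigs ρ) := rfl
    rw [hv]
    linarith
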